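/- arXiv:1506.00207 — 8 statements merged into one kernel-verified Lean document; each statement's English description precedes it below -/
import Mathlib

section
/- Let 𝔤 be a Lie algebra over ℝ, let X ∈ 𝔤 be a nonzero element spanning a one-dimensional ideal with weight functional η (so [A, X] = η(A)·X for all A), and let F₀ : 𝔤 × 𝔤 → ℝ be an alternating bilinear form. Then the sheared bracket ⟦u, v⟧ := [u, v] − F₀(u, v)·X satisfies the Jacobi identity (and hence, being alternating, defines a Lie algebra structure on the underlying vector space of 𝔤) if and only if the shear condition holds: for all u, v, w ∈ 𝔤, F₀([u,v],w) + F₀([v,w],u) + F₀([w,u],v) = (η(u)+F₀(X,u))·F₀(v,w) + (η(v)+F₀(X,v))·F₀(w,u) + (η(w)+F₀(X,w))·F₀(u,v). -/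
/-- The sheared bracket `⟦u,v⟧ = ⁅u,v⁆ - F₀ u v • X` satisfies the Jacobi identity if and
only if the shear condition holds for `(X, η, F₀)`. -/
theorem sheared_bracket_jacobi_iff_shear_condition
    {L : Type*} [LieRing L] [LieAlgebra ℝ L]
    (X : L) (hX : X ≠ 0) (η : L →ₗ[ℝ] ℝ)
    (hideal : ∀ A : L, ⁅A, X⁆ = η A • X)
    (F₀ : L →ₗ[ℝ] L →ₗ[ℝ] ℝ) (hAlt : ∀ u : L, F₀ u u = 0)
    (B : L → L → L) (hB : ∀ u v : L, B u v = ⁅u, v⁆ - F₀ u v • X) :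
    (∀ u v w : L, B u (B v w) + B v (B w u) + B w (B u v) = 0) ↔
      (∀ u v w : L, F₀ ⁅u, v⁆ w + F₀ ⁅v, w⁆ u + F₀ ⁅w, u⁆ v =
        (η u + F₀ X u) * F₀ v w + (η v + F₀ X v) * F₀ w u +
          (η w + F₀ X w) * F₀ u v) := by
  have hskew : ∀ a b : L, F₀ a b = -F₀ b a := fun a b =>
    (LinearMap.IsAlt.neg (B := F₀) hAlt b a).symm
  have hnested : ∀ u v w : L, B u (B v w) =
      ⁅u, ⁅v, w⁆⁆ + (F₀ ⁅v, w⁆ u - (η u + F₀ X u) * F₀ v w) • X := by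
    intro u v w
    rw [hB v w, hB, lie_sub, lie_smul, hideal, map_sub, map_smul, hskew u ⁅v, w⁆,
      hskew u X, smul_eq_mul]
    module
  refine forall_congr' fun u => forall_congr' fun v => forall_congr' fun w => ?_
  have hsum : B u (B v w) + B v (B w u) + B w (B u v) =
      (F₀ ⁅u, v⁆ w + F₀ ⁅v, w⁆ u + F₀ ⁅w, u⁆ v -
        ((η u + F₀ X u) * F₀ v w + (η v + F₀ X v) * F₀ w u +
          (η w + F₀ X w) * F₀ u v)) • X := by
    rw [hnested, hnested, hnested, ← sub_eq_zero, ← lie_jacobi u v w]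
    module
  rw [hsum, smul_eq_zero_iff_left hX, sub_eq_zero]
end

section
/- Let 𝔤 be a Lie algebra over ℝ, let X ∈ 𝔤 be a nonzero element spanning a one-dimensional ideal with weight functional η (so [A, X] = η(A)·X for all A), and let α : 𝔤 → ℝ be linear with α(X) = 1. Define ⟦u, v⟧ := [u, v] − α([u, v])·X. Then: (i) ⟦·,·⟧ is a Lie bracket on the underlying vector space of 𝔤; (ii) X is central for ⟦·,·⟧; (iii) the hyperplane ker α is an ideal of (𝔤, ⟦·,·⟧); and (iv) the quotient map 𝔤 → 𝔤/(ℝ·X) restricts to a Lie algebra isomorphism from (ker α, ⟦·,·⟧) onto the quotient Lie algebra 𝔤/(ℝ·X). Hence (𝔤, ⟦·,·⟧) is the Lie algebra direct sum of the one-dimensional center ℝ·X and an ideal isomorphic to 𝔤/(ℝ·X). (This is the paper's claim that the choice F₀ = −dα produces the product algebra (𝔤/ξ) ⊕ ℝ.) -/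
/-- Shearing by `F₀ = -dα` (i.e. `⟦u,v⟧ = ⁅u,v⁆ - α ⁅u,v⁆ • X`) produces a product algebra:
(i) `⟦·,·⟧` is a Lie bracket; (ii) `X` is central for it; (iii) `ker α` is an ideal for it;
(iv) the quotient map `L → L ⧸ ℝ·X` intertwines `⟦·,·⟧` with the quotient bracket and
restricts to a bijection on `ker α`. -/
theorem shear_by_minus_dalpha_gives_product
    {L : Type*} [LieRing L] [LieAlgebra ℝ L]
    (X : L) (hX : X ≠ 0) (η α : L →ₗ[ℝ] ℝ)
    (hideal : ∀ A : L, ⁅A, X⁆ = η A • X) (hα : α X = 1)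
    (B : L → L → L) (hB : ∀ u v : L, B u v = ⁅u, v⁆ - α ⁅u, v⁆ • X)
    (I : LieIdeal ℝ L) (hI : (I : Submodule ℝ L) = Submodule.span ℝ {X}) :
    ((∀ u : L, B u u = 0) ∧
      ∀ u v w : L, B u (B v w) + B v (B w u) + B w (B u v) = 0) ∧
    (∀ A : L, B A X = 0) ∧
    (∀ u v : L, v ∈ LinearMap.ker α → B u v ∈ LinearMap.ker α) ∧
    (∀ u v : L, LieSubmodule.Quotient.mk' I (B u v) =
        ⁅LieSubmodule.Quotient.mk' I u, LieSubmodule.Quotient.mk' I v⁆) ∧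
    Function.Bijective
      (fun u : LinearMap.ker α => LieSubmodule.Quotient.mk' I (u : L)) := by
  have mem_iff : ∀ x : L, x ∈ I ↔ x ∈ Submodule.span ℝ {X} := fun x => by
    rw [← hI]
    exact Iff.rfl
  have hmkX : LieSubmodule.Quotient.mk' I X = 0 := by
    rw [LieSubmodule.Quotient.mk_eq_zero, mem_iff]
    exact Submodule.mem_span_singleton_self X
  have hBB : ∀ u v w : L, B u (B v w) = ⁅u, ⁅v, w⁆⁆ - α ⁅u, ⁅v, w⁆⁆ • X := by
    intro u v w
    simp only [hB, lie_sub, lie_smul, hideal, map_sub, map_smul, hα, smul_eq_mul, mul_one]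
    module
  refine ⟨⟨fun u => by simp [hB], fun u v w => ?_⟩, fun A => by simp [hB, hideal, hα],
    fun u v _ => by simp [hB, hα], fun u v => ?_, ?_, fun y => ?_⟩
  · have hsum : ⁅u, ⁅v, w⁆⁆ + ⁅v, ⁅w, u⁆⁆ + ⁅w, ⁅u, v⁆⁆ = 0 := lie_jacobi u v w
    calc B u (B v w) + B v (B w u) + B w (B u v)
        = (⁅u, ⁅v, w⁆⁆ + ⁅v, ⁅w, u⁆⁆ + ⁅w, ⁅u, v⁆⁆)
            - α (⁅u, ⁅v, w⁆⁆ + ⁅v, ⁅w, u⁆⁆ + ⁅w, ⁅u, v⁆⁆) • X := by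
          simp only [hBB, map_add]
          module
      _ = 0 := by simp [hsum]
  · rw [hB, map_sub, map_smul, hmkX, smul_zero, sub_zero]
    exact LieSubmodule.Quotient.mk_bracket I u v
  · rintro ⟨u, hu⟩ ⟨v, hv⟩ huv
    have hmem : u - v ∈ Submodule.span ℝ {X} := by
      rw [← mem_iff, ← LieSubmodule.Quotient.mk_eq_zero, map_sub]
      exact sub_eq_zero.mpr huv
    obtain ⟨c, hc⟩ := Submodule.mem_span_singleton.mp hmem
    have hc0 : c = 0 := by
      simpa [hα, LinearMap.mem_ker.mp hu, LinearMap.mem_ker.mp hv] using congrArg α hc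
    rw [hc0, zero_smul] at hc
    exact Subtype.ext (sub_eq_zero.mp hc.symm)
  · obtain ⟨u, rfl⟩ := LieSubmodule.Quotient.surjective_mk' I y
    refine ⟨⟨u - α u • X, by simp [hα]⟩, ?_⟩
    simp only [map_sub, map_smul, hmkX, smul_zero, sub_zero]
end

section
/- Let 𝔤 be a Lie algebra over ℝ and let X ∈ 𝔤 be a nonzero element spanning a one-dimensional ideal with weight functional η, and suppose the alternating bilinear form F₀ satisfies the shear condition for (X, η, F₀), so that the sheared bracket ⟦u, v⟧ := [u, v] − F₀(u, v)·X is a Lie bracket. Then: (i) ℝ·X is a one-dimensional ideal of (𝔤, ⟦·,·⟧) with weight functional η₀ given by η₀(A) := η(A) + F₀(X, A), i.e. ⟦A, X⟧ = η₀(A)·X for all A (this corresponds to the paper's η₀ = η − ι_X F₀); (ii) the form −F₀ satisfies the shear condition for (X, η₀, −F₀) with respect to the Lie algebra (𝔤, ⟦·,·⟧); and (iii) shearing (𝔤, ⟦·,·⟧) by −F₀ returns the original bracket: ⟦u, v⟧ − (−F₀)(u, v)·X = [u, v] for all u, v. -/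
/-- For a sheared bracket `⟦u,v⟧ = ⁅u,v⁆ - F₀ u v • X`: (i) `ℝ·X` is an ideal for `⟦·,·⟧`
with weight functional `η₀ = η + ι_X F₀ (·)`; (ii) `-F₀` satisfies the shear condition for
`(X, η₀, -F₀)` with respect to `⟦·,·⟧`; (iii) shearing `⟦·,·⟧` by `-F₀` recovers `⁅·,·⁆`. -/
theorem shear_inverted_by_minus_F₀
    {L : Type*} [LieRing L] [LieAlgebra ℝ L]
    (X : L) (hX : X ≠ 0) (η : L →ₗ[ℝ] ℝ)
    (hideal : ∀ A : L, ⁅A, X⁆ = η A • X)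
    (F₀ : L →ₗ[ℝ] L →ₗ[ℝ] ℝ) (hAlt : ∀ u : L, F₀ u u = 0)
    (hshear : ∀ u v w : L, F₀ ⁅u, v⁆ w + F₀ ⁅v, w⁆ u + F₀ ⁅w, u⁆ v =
      (η u + F₀ X u) * F₀ v w + (η v + F₀ X v) * F₀ w u + (η w + F₀ X w) * F₀ u v)
    (B : L → L → L) (hB : ∀ u v : L, B u v = ⁅u, v⁆ - F₀ u v • X)
    (η₀ : L → ℝ) (hη₀ : ∀ A : L, η₀ A = η A + F₀ X A) :
    (∀ A : L, B A X = η₀ A • X) ∧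
    (∀ u v w : L, -(F₀ (B u v) w) + -(F₀ (B v w) u) + -(F₀ (B w u) v) =
      (η₀ u + -(F₀ X u)) * -(F₀ v w) + (η₀ v + -(F₀ X v)) * -(F₀ w u) +
        (η₀ w + -(F₀ X w)) * -(F₀ u v)) ∧
    (∀ u v : L, B u v - (-(F₀ u v)) • X = ⁅u, v⁆) := by
  refine ⟨fun A => ?_, fun u v w => ?_, fun u v => ?_⟩
  · have hskew : F₀ A X = -F₀ X A := (LinearMap.IsAlt.neg hAlt X A).symm
    rw [hB, hideal, hη₀, hskew]
    module
  · simp only [hB, hη₀, map_sub, map_smul, LinearMap.sub_apply, LinearMap.smul_apply, smul_eq_mul]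
    linear_combination -hshear u v w
  · rw [hB]
    module
end

section
/- Let 𝔤 be a Lie algebra over ℝ, let X ∈ 𝔤 be a nonzero element spanning a one-dimensional ideal with weight functional η, and let F₀ : 𝔤 × 𝔤 → ℝ be an alternating bilinear form. Then the shear-condition identity F₀([u,v],w) + F₀([v,w],u) + F₀([w,u],v) = (η(u)+F₀(X,u))·F₀(v,w) + (η(v)+F₀(X,v))·F₀(w,u) + (η(w)+F₀(X,w))·F₀(u,v) holds for all triples with w = X (i.e. for all (u, v, X), u, v ∈ 𝔤) if and only if F₀(X, [u, v]) = 0 for all u, v ∈ 𝔤, i.e. if and only if the functional ι_X F₀ vanishes on the derived algebra of 𝔤. In particular, if the sheared bracket ⟦u, v⟧ := [u, v] − F₀(u, v)·X satisfies the Jacobi identity, then F₀(X, [u, v]) = 0 for all u, v (the paper's condition dη₀ = 0). -/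
/-- If the bracket sheared along `X` satisfies the Jacobi identity, then the shear condition holds
for all triples. -/
theorem shear_condition_of_jacobi
    {L : Type*} [LieRing L] [LieAlgebra ℝ L]
    {X : L} (hX : X ≠ 0) {η : L →ₗ[ℝ] ℝ}
    (hideal : ∀ A : L, ⁅A, X⁆ = η A • X)
    {F₀ : L →ₗ[ℝ] L →ₗ[ℝ] ℝ} (hAlt : F₀.IsAlt)
    {B : L → L → L} (hB : ∀ u v : L, B u v = ⁅u, v⁆ - F₀ u v • X)
    {u v w : L} (hJ : B u (B v w) + B v (B w u) + B w (B u v) = 0) :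
    F₀ ⁅u, v⁆ w + F₀ ⁅v, w⁆ u + F₀ ⁅w, u⁆ v =
      (η u + F₀ X u) * F₀ v w + (η v + F₀ X v) * F₀ w u + (η w + F₀ X w) * F₀ u v := by
  have hBB : ∀ a b c : L, B a (B b c) =
      ⁅a, ⁅b, c⁆⁆ + (F₀ ⁅b, c⁆ a - (η a + F₀ X a) * F₀ b c) • X := by
    intro a b c
    simp only [hB, lie_sub, lie_smul, hideal, map_sub, map_smul, smul_eq_mul,
      ← hAlt.neg a ⁅b, c⁆, ← hAlt.neg a X]
    module
  rw [hBB, hBB, hBB] at hJ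
  have hsmul : ((F₀ ⁅v, w⁆ u - (η u + F₀ X u) * F₀ v w) +
      (F₀ ⁅w, u⁆ v - (η v + F₀ X v) * F₀ w u) +
      (F₀ ⁅u, v⁆ w - (η w + F₀ X w) * F₀ u v)) • X = 0 := by
    rw [← hJ, ← sub_eq_zero, ← neg_eq_zero, ← lie_jacobi u v w]
    module
  linarith [(smul_eq_zero.mp hsmul).resolve_right hX]

/-- The shear-condition identity evaluated on triples `(u, v, X)` holds (for all `u, v`) iff
`ι_X F₀` vanishes on the derived algebra; in particular, if the sheared bracket satisfies the
Jacobi identity then `F₀ X ⁅u,v⁆ = 0` for all `u, v`. -/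
theorem shear_condition_at_X_iff_contraction_closed
    {L : Type*} [LieRing L] [LieAlgebra ℝ L]
    (X : L) (hX : X ≠ 0) (η : L →ₗ[ℝ] ℝ)
    (hideal : ∀ A : L, ⁅A, X⁆ = η A • X)
    (F₀ : L →ₗ[ℝ] L →ₗ[ℝ] ℝ) (hAlt : ∀ u : L, F₀ u u = 0)
    (B : L → L → L) (hB : ∀ u v : L, B u v = ⁅u, v⁆ - F₀ u v • X) :
    ((∀ u v : L, F₀ ⁅u, v⁆ X + F₀ ⁅v, X⁆ u + F₀ ⁅X, u⁆ v =
        (η u + F₀ X u) * F₀ v X + (η v + F₀ X v) * F₀ X u +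
          (η X + F₀ X X) * F₀ u v) ↔
      (∀ u v : L, F₀ X ⁅u, v⁆ = 0)) ∧
    ((∀ u v w : L, B u (B v w) + B v (B w u) + B w (B u v) = 0) →
      ∀ u v : L, F₀ X ⁅u, v⁆ = 0) := by
  have hF : F₀.IsAlt := hAlt
  have hηX : η X = 0 :=
    (smul_eq_zero.mp ((hideal X).symm.trans (lie_self X))).resolve_right hX
  have hiff : (∀ u v : L, F₀ ⁅u, v⁆ X + F₀ ⁅v, X⁆ u + F₀ ⁅X, u⁆ v =
        (η u + F₀ X u) * F₀ v X + (η v + F₀ X v) * F₀ X u +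
          (η X + F₀ X X) * F₀ u v) ↔
      (∀ u v : L, F₀ X ⁅u, v⁆ = 0) := by
    refine forall₂_congr fun u v => ?_
    rw [← lie_skew X u, hideal, hideal, hηX, hAlt X, ← hF.neg X ⁅u, v⁆, ← hF.neg X v]
    simp only [map_neg, map_smul, LinearMap.neg_apply, LinearMap.smul_apply, smul_eq_mul]
    constructor <;> intro h <;> linarith
  exact ⟨hiff, fun hJ => hiff.mp fun u v =>
    shear_condition_of_jacobi hX hideal hF hB (hJ u v X)⟩
end

section
/- Let 𝔤 be a Lie algebra over ℝ and let X ∈ 𝔤 be a nonzero element spanning a one-dimensional ideal with weight functional η, and let α : 𝔤 → ℝ be linear with α(X) = 1. Let ⟦u, v⟧ := [u, v] − α([u, v])·X (which is a Lie bracket for which X is central, isomorphic to the product ℝ ⊕ 𝔤/(ℝ·X)). Define G₀(u, v) := −α([u, v]). Then G₀ satisfies the shear condition for the Lie algebra (𝔤, ⟦·,·⟧) with element X and weight functional 0, i.e. G₀(⟦u,v⟧,w) + G₀(⟦v,w⟧,u) + G₀(⟦w,u⟧,v) = G₀(X,u)·G₀(v,w) + G₀(X,v)·G₀(w,u) + G₀(X,w)·G₀(u,v)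 for all u, v, w, and the shear of (𝔤, ⟦·,·⟧) by G₀ recovers the original bracket: ⟦u, v⟧ − G₀(u, v)·X = [u, v] for all u, v. Hence every Lie algebra with a one-dimensional ideal ℝ·X arises as a shear of a product Lie algebra ℝ ⊕ 𝔤/(ℝ·X). -/
/-- Every Lie algebra with a one-dimensional ideal `ℝ·X` is a shear of the product algebra:
with `⟦u,v⟧ = ⁅u,v⁆ - α ⁅u,v⁆ • X` and `G₀ u v = -α ⁅u,v⁆`, the form `G₀` satisfies the
shear condition for `(𝔤, ⟦·,·⟧)` with element `X` and weight functional `0`, and shearing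
`⟦·,·⟧` by `G₀` recovers the original bracket. -/
theorem original_bracket_is_shear_of_product
    {L : Type*} [LieRing L] [LieAlgebra ℝ L]
    (X : L) (hX : X ≠ 0) (η α : L →ₗ[ℝ] ℝ)
    (hideal : ∀ A : L, ⁅A, X⁆ = η A • X) (hα : α X = 1)
    (B : L → L → L) (hB : ∀ u v : L, B u v = ⁅u, v⁆ - α ⁅u, v⁆ • X)
    (G₀ : L → L → ℝ) (hG₀ : ∀ u v : L, G₀ u v = -α ⁅u, v⁆) :
    (∀ u v w : L, G₀ (B u v) w + G₀ (B v w) u + G₀ (B w u) v =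
      G₀ X u * G₀ v w + G₀ X v * G₀ w u + G₀ X w * G₀ u v) ∧
    (∀ u v : L, B u v - G₀ u v • X = ⁅u, v⁆) := by
  have hXα (w : L) : α ⁅X, w⁆ = -η w := by
    rw [← lie_skew, hideal, map_neg, map_smul, hα, smul_eq_mul, mul_one]
  refine ⟨fun u v w => ?_, fun u v => ?_⟩
  · have jacobi : α ⁅⁅u, v⁆, w⁆ + α ⁅⁅v, w⁆, u⁆ + α ⁅⁅w, u⁆, v⁆ = 0 := by
      have h := congrArg α (lie_jacobi u v w)
      rw [← lie_skew ⁅v, w⁆ u, ← lie_skew ⁅w, u⁆ v, ← lie_skew ⁅u, v⁆ w]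
      simp only [map_add, map_neg, map_zero] at h ⊢
      linear_combination -h
    simp only [hG₀, hB, sub_lie, smul_lie, map_sub, map_smul, hXα, smul_eq_mul]
    linear_combination -jacobi
  · rw [hB, hG₀, neg_smul, sub_neg_eq_add, sub_add_cancel]
end

section
/- Let V be a finite-dimensional real vector space. Define a binary relation 'is a twist of' on Lie brackets on V as follows: a bracket B₂ is a twist of a bracket B₁ if there exist X ∈ V and an alternating bilinear form F : V × V → ℝ such that X is central for B₁, F(X, w) = 0 for all w, F is a 2-cocycle for B₁ (i.e. F(B₁(u,v),w) + F(B₁(v,w),u) + F(B₁(w,u),v) = 0 for all u,v,w), and B₂(u, v) = B₁(u, v) − F(u, v)·X for all u, v. Then for every Lie bracket B on V making V a nilpotent Lie algebra, B is related to the zero (Abelian) bracket by the reflexive–transitive closure of this twist relation; that is, every nilpotent Lie algebra may be obtained from repeated twists of an Abelian Lie algebra of the same dimension. -/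
/-- A Lie bracket on a real vector space `V`: an alternating bilinear map satisfying the
Jacobi identity. -/
def IsLieBracketOn {V : Type*} [AddCommGroup V] [Module ℝ V]
    (B : V →ₗ[ℝ] V →ₗ[ℝ] V) : Prop :=
  (∀ u : V, B u u = 0) ∧
    ∀ u v w : V, B u (B v w) + B v (B w u) + B w (B u v) = 0

/-- The lower central series of a bracket `B` on `V`. -/
def bracketLowerCentralSeries {V : Type*} [AddCommGroup V] [Module ℝ V]
    (B : V →ₗ[ℝ] V →ₗ[ℝ] V) : ℕ → Submodule ℝ V
  | 0 => ⊤
  | n + 1 =>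
      Submodule.span ℝ
        {x : V | ∃ u v : V, v ∈ bracketLowerCentralSeries B n ∧ x = B u v}

/-- A bracket is nilpotent if its lower central series terminates in zero. -/
def IsNilpotentBracket {V : Type*} [AddCommGroup V] [Module ℝ V]
    (B : V →ₗ[ℝ] V →ₗ[ℝ] V) : Prop :=
  ∃ n : ℕ, bracketLowerCentralSeries B n = ⊥

/-- `B₂` is a twist of `B₁` if there are `X` central for `B₁` and an alternating 2-cocycle
`F` for `B₁` with `ι_X F = 0` such that `B₂ u v = B₁ u v - F u v • X`. -/
def IsTwistOf {V : Type*} [AddCommGroup V] [Module ℝ V]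
    (B₂ B₁ : V →ₗ[ℝ] V →ₗ[ℝ] V) : Prop :=
  ∃ (X : V) (F : V →ₗ[ℝ] V →ₗ[ℝ] ℝ),
    (∀ A : V, B₁ A X = 0) ∧ (∀ u : V, F u u = 0) ∧ (∀ w : V, F X w = 0) ∧
    (∀ u v w : V, F (B₁ u v) w + F (B₁ v w) u + F (B₁ w u) v = 0) ∧
    ∀ u v : V, B₂ u v = B₁ u v - F u v • X

section

variable {V : Type*} [AddCommGroup V] [Module ℝ V] {B : V →ₗ[ℝ] V →ₗ[ℝ] V}

theorem IsLieBracketOn.swap (hB : IsLieBracketOn B) (u v : V) : B u v = -B v u := by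
  have h := hB.1 (u + v)
  simp only [map_add, LinearMap.add_apply, hB.1, zero_add, add_zero] at h
  rw [add_comm] at h
  exact eq_neg_of_add_eq_zero_left h

theorem bracket_mem_bracketLowerCentralSeries_succ {n : ℕ} (u : V) {v : V}
    (hv : v ∈ bracketLowerCentralSeries B n) : B u v ∈ bracketLowerCentralSeries B (n + 1) :=
  Submodule.subset_span ⟨u, v, hv, rfl⟩

theorem bracketLowerCentralSeries_succ_le_one (n : ℕ) :
    bracketLowerCentralSeries B (n + 1) ≤ bracketLowerCentralSeries B 1 := by
  refine Submodule.span_le.2 ?_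
  rintro _ ⟨u, v, -, rfl⟩
  exact bracket_mem_bracketLowerCentralSeries_succ u Submodule.mem_top

/-- A nonzero nilpotent bracket has a nonzero central element in its derived subspace. -/
theorem IsNilpotentBracket.exists_central (hnil : IsNilpotentBracket B) (h0 : B ≠ 0) :
    ∃ X ∈ bracketLowerCentralSeries B 1, X ≠ 0 ∧ ∀ A : V, B A X = 0 := by
  have hone : bracketLowerCentralSeries B 1 ≠ ⊥ := by
    refine fun h => h0 (LinearMap.ext₂ fun u v => ?_)
    simpa [h] using
      bracket_mem_bracketLowerCentralSeries_succ (B := B) (n := 0) u (v := v) Submodule.mem_top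
  obtain ⟨k, hne, hbot⟩ : ∃ k, bracketLowerCentralSeries B (k + 1) ≠ ⊥ ∧
      bracketLowerCentralSeries B (k + 2) = ⊥ := by
    by_contra! h
    have hall : ∀ k, bracketLowerCentralSeries B (k + 1) ≠ ⊥ := fun k => by
      induction k with
      | zero => exact hone
      | succ k ih => exact h k ih
    obtain ⟨n, hn⟩ := hnil
    refine hall n ((Submodule.eq_bot_iff _).2 fun x hx => ?_)
    have hle : bracketLowerCentralSeries B (n + 1) ≤ ⊥ := by
      refine Submodule.span_le.2 ?_
      rintro _ ⟨u, v, hv, rfl⟩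
      rw [hn, Submodule.mem_bot] at hv
      simp [hv]
    exact hle hx
  obtain ⟨X, hX, hX0⟩ := Submodule.exists_mem_ne_zero_of_ne_bot hne
  refine ⟨X, bracketLowerCentralSeries_succ_le_one k hX, hX0, fun A => ?_⟩
  simpa [hbot] using bracket_mem_bracketLowerCentralSeries_succ A hX

/-- The bracket `B u v - l (B u v) • X`. -/
def exactTwist (B : V →ₗ[ℝ] V →ₗ[ℝ] V) (l : V →ₗ[ℝ] ℝ) (X : V) : V →ₗ[ℝ] V →ₗ[ℝ] V :=
  B.compr₂ (LinearMap.id - l.smulRight X)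

@[simp]
theorem exactTwist_apply (l : V →ₗ[ℝ] ℝ) (X u v : V) :
    exactTwist B l X u v = B u v - l (B u v) • X := by
  simp [exactTwist]

variable {l : V →ₗ[ℝ] ℝ} {X : V}

theorem IsLieBracketOn.isTwistOf_exactTwist (hB : IsLieBracketOn B) (hX : ∀ A : V, B A X = 0) :
    IsTwistOf (exactTwist B l X) B := by
  refine ⟨X, B.compr₂ l, hX, fun u => by simp [hB.1], fun w => by simp [hB.swap X, hX],
    fun u v w => ?_, fun u v => by simp⟩
  simp only [LinearMap.compr₂_apply]
  have h := congrArg l (hB.2 u v w)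
  simp only [map_add, map_zero] at h
  rw [hB.swap (B u v), hB.swap (B v w), hB.swap (B w u)]
  simp only [map_neg]
  linarith

theorem IsLieBracketOn.exactTwist (hB : IsLieBracketOn B) (hX : ∀ A : V, B A X = 0) :
    IsLieBracketOn (exactTwist B l X) := by
  refine ⟨fun u => by simp [hB.1], fun u v w => ?_⟩
  have h (a b c : V) : _root_.exactTwist B l X a (_root_.exactTwist B l X b c) =
      (LinearMap.id - l.smulRight X : V →ₗ[ℝ] V) (B a (B b c)) := by
    simp [hX]
  rw [h, h, h, ← map_add, ← map_add, hB.2, map_zero]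

theorem IsNilpotentBracket.exactTwist (hnil : IsNilpotentBracket B) (hX : ∀ A : V, B A X = 0) :
    IsNilpotentBracket (exactTwist B l X) := by
  have hle (n : ℕ) : bracketLowerCentralSeries (_root_.exactTwist B l X) n ≤
      bracketLowerCentralSeries B n ⊔ Submodule.span ℝ {X} := by
    induction n with
    | zero => exact le_sup_left
    | succ n ih =>
      refine Submodule.span_le.2 ?_
      rintro _ ⟨u, v, hv, rfl⟩
      obtain ⟨a, ha, b, hb, rfl⟩ := Submodule.mem_sup.1 (ih hv)
      obtain ⟨c, rfl⟩ := Submodule.mem_span_singleton.1 hb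
      rw [exactTwist_apply, map_add, map_smul, hX, smul_zero, add_zero]
      exact sub_mem
        (Submodule.mem_sup_left (bracket_mem_bracketLowerCentralSeries_succ u ha))
        (Submodule.mem_sup_right
          (Submodule.smul_mem _ _ (Submodule.mem_span_singleton_self X)))
  obtain ⟨n, hn⟩ := hnil
  refine ⟨n + 1, le_bot_iff.1 (Submodule.span_le.2 ?_)⟩
  rintro _ ⟨u, v, hv, rfl⟩
  have hvX := hle n hv
  rw [hn, bot_sup_eq] at hvX
  obtain ⟨c, rfl⟩ := Submodule.mem_span_singleton.1 hvX
  simp [hX]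

theorem bracketLowerCentralSeries_one_exactTwist_lt (hX : X ∈ bracketLowerCentralSeries B 1)
    (hl : l X = 1) :
    bracketLowerCentralSeries (exactTwist B l X) 1 < bracketLowerCentralSeries B 1 := by
  have hle : bracketLowerCentralSeries (exactTwist B l X) 1 ≤
      bracketLowerCentralSeries B 1 ⊓ LinearMap.ker l := by
    refine Submodule.span_le.2 ?_
    rintro _ ⟨u, v, -, rfl⟩
    refine ⟨?_, by simp [hl]⟩
    rw [exactTwist_apply]
    exact sub_mem (bracket_mem_bracketLowerCentralSeries_succ u Submodule.mem_top)
      (Submodule.smul_mem _ _ hX)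
  refine lt_of_le_of_ne (hle.trans inf_le_left) fun h => ?_
  rw [← h] at hX
  have hker : l X = 0 := (hle hX).2
  exact one_ne_zero (hl.symm.trans hker)

end

/-- Every nilpotent Lie bracket on a finite-dimensional real vector space is related to the
Abelian (zero) bracket by the reflexive–transitive closure of the twist relation: every
nilpotent Lie algebra is obtained from repeated twists of an Abelian one of the same
dimension. -/
theorem nilpotent_bracket_reflTransGen_twist_zero
    {V : Type*} [AddCommGroup V] [Module ℝ V] [FiniteDimensional ℝ V]
    (B : V →ₗ[ℝ] V →ₗ[ℝ] V) (hB : IsLieBracketOn B)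
    (hnil : IsNilpotentBracket B) :
    Relation.ReflTransGen (fun B₁ B₂ => IsTwistOf B₂ B₁) B 0 := by
  by_cases h0 : B = 0
  · rw [h0]
  obtain ⟨X, hX1, hX0, hX⟩ := hnil.exists_central h0
  obtain ⟨l, hl⟩ := Module.Projective.exists_dual_eq_one ℝ hX0
  have hlt := Submodule.finrank_lt_finrank_of_lt
    (bracketLowerCentralSeries_one_exactTwist_lt hX1 hl)
  exact .head (hB.isTwistOf_exactTwist hX) (nilpotent_bracket_reflTransGen_twist_zero
    (exactTwist B l X) (hB.exactTwist hX) (hnil.exactTwist hX))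
termination_by Module.finrank ℝ (bracketLowerCentralSeries B 1)
end

section
/- Let V be a finite-dimensional real vector space and let ω, τ : V × V → ℝ be alternating bilinear forms. Suppose ω has rank at least 6, in the sense that the linear map V → V* sending v to ω(v, ·) has rank at least 6. If the wedge product ω ∧ τ is the zero alternating 4-form, then τ = 0. Here ω ∧ τ is the alternating 4-form given by (ω∧τ)(x₁,x₂,x₃,x₄) = ω(x₁,x₂)τ(x₃,x₄) − ω(x₁,x₃)τ(x₂,x₄) + ω(x₁,x₄)τ(x₂,x₃) + ω(x₂,x₃)τ(x₁,x₄) − ω(x₂,x₄)τ(x₁,x₃) + ω(x₃,x₄)τ(x₁,x₂). -/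
open Module Submodule

/-- If `p x` differs from `x` by an element of `span s` and is `ω`-orthogonal to `s`, where `s` has
fewer elements than the rank of `ω`, then `ω` does not vanish on the image of `p`. -/
theorem exists_apply_ne_zero_of_card_lt_finrank_range
    {K V : Type*} [Field K] [AddCommGroup V] [Module K V]
    (ω : V →ₗ[K] V →ₗ[K] K) (s : Finset V) (hs : s.card < finrank K (LinearMap.range ω))
    (p : V → V) (hp : ∀ x, x - p x ∈ span K (s : Set V))
    (hps : ∀ x, ∀ v ∈ s, ω (p x) v = 0) :
    ∃ x y, ω (p x) (p y) ≠ 0 := by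
  by_contra! h
  have hspan (x : V) : span K (s : Set V) ≤ LinearMap.ker (ω (p x)) :=
    span_le.2 fun v hv => hps x v hv
  have hker (x : V) : ω (p x) = 0 := by
    ext y
    have hy : ω (p x) (y - p y) = 0 := hspan x (hp y)
    simpa [h] using hy
  have hle : LinearMap.range ω ≤ (span K (s : Set V)).map ω := by
    rintro _ ⟨x, rfl⟩
    exact ⟨x - p x, hp x, by simp [hker]⟩
  have := (finrank_mono hle).trans ((finrank_map_le ω _).trans (finrank_span_finset_le_card s))
  omega

/-- The projection onto the `ω`-orthogonal complement of the plane spanned by `a` and `b`,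
meaningful for an alternating form `ω` with `ω a b ≠ 0`. -/
def hyperbolicComplProj {K V : Type*} [Field K] [AddCommGroup V] [Module K V]
    (ω : V →ₗ[K] V →ₗ[K] K) (a b x : V) : V :=
  x - (ω x b / ω a b) • a + (ω x a / ω a b) • b

section hyperbolicComplProj

variable {K V : Type*} [Field K] [AddCommGroup V] [Module K V]
  {ω : V →ₗ[K] V →ₗ[K] K} {a b : V}

theorem sub_hyperbolicComplProj_mem {S : Submodule K V} (ha : a ∈ S) (hb : b ∈ S) (x : V) :
    x - hyperbolicComplProj ω a b x ∈ S := by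
  have : x - hyperbolicComplProj ω a b x = (ω x b / ω a b) • a - (ω x a / ω a b) • b := by
    simp only [hyperbolicComplProj]; abel
  rw [this]
  exact S.sub_mem (S.smul_mem _ ha) (S.smul_mem _ hb)

theorem apply_hyperbolicComplProj_left (hω : ω.IsAlt) (hab : ω a b ≠ 0) (x : V) :
    ω (hyperbolicComplProj ω a b x) a = 0 := by
  simp [hyperbolicComplProj, hω a, ← hω.neg a b, hab]

theorem apply_hyperbolicComplProj_right (hω : ω.IsAlt) (hab : ω a b ≠ 0) (x : V) :
    ω (hyperbolicComplProj ω a b x) b = 0 := by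
  simp [hyperbolicComplProj, hω b, hab]

theorem apply_hyperbolicComplProj_of_ortho {x v : V} (ha : ω a v = 0) (hb : ω b v = 0) :
    ω (hyperbolicComplProj ω a b x) v = ω x v := by
  simp [hyperbolicComplProj, ha, hb]

/-- An alternating form of rank greater than `2` is nonzero on the orthogonal complement of any
hyperbolic plane. -/
theorem exists_hyperbolic_pair_ortho (hω : ω.IsAlt) (hrank : 2 < finrank K (LinearMap.range ω))
    (hab : ω a b ≠ 0) :
    ∃ c d, ω c d ≠ 0 ∧ ω c a = 0 ∧ ω c b = 0 ∧ ω d a = 0 ∧ ω d b = 0 := by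
  classical
  have ha := apply_hyperbolicComplProj_left hω hab
  have hb := apply_hyperbolicComplProj_right hω hab
  obtain ⟨x, y, h⟩ := exists_apply_ne_zero_of_card_lt_finrank_range ω {a, b}
    (Finset.card_le_two.trans_lt hrank) (hyperbolicComplProj ω a b)
    (sub_hyperbolicComplProj_mem (subset_span (by simp)) (subset_span (by simp)))
    (by simp [ha, hb])
  exact ⟨_, _, h, ha x, hb x, ha y, hb y⟩

/-- An alternating form of rank greater than `4` is nonzero on the orthogonal complement of any two
orthogonal hyperbolic planes. -/
theorem exists_hyperbolic_pair_ortho_of_pairs (hω : ω.IsAlt)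
    (hrank : 4 < finrank K (LinearMap.range ω)) (hab : ω a b ≠ 0) {c d : V} (hcd : ω c d ≠ 0)
    (hca : ω c a = 0) (hcb : ω c b = 0) (hda : ω d a = 0) (hdb : ω d b = 0) :
    ∃ e f, ω e f ≠ 0 ∧ (ω e a = 0 ∧ ω e b = 0 ∧ ω e c = 0 ∧ ω e d = 0) ∧
      ω f a = 0 ∧ ω f b = 0 ∧ ω f c = 0 ∧ ω f d = 0 := by
  classical
  let p (x : V) := hyperbolicComplProj ω c d (hyperbolicComplProj ω a b x)
  have hp (x : V) : ω (p x) a = 0 ∧ ω (p x) b = 0 ∧ ω (p x) c = 0 ∧ ω (p x) d = 0 :=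
    ⟨(apply_hyperbolicComplProj_of_ortho hca hda).trans (apply_hyperbolicComplProj_left hω hab x),
      (apply_hyperbolicComplProj_of_ortho hcb hdb).trans (apply_hyperbolicComplProj_right hω hab x),
      apply_hyperbolicComplProj_left hω hcd _, apply_hyperbolicComplProj_right hω hcd _⟩
  obtain ⟨x, y, h⟩ := exists_apply_ne_zero_of_card_lt_finrank_range ω {a, b, c, d}
    (Finset.card_le_four.trans_lt hrank) p
    (fun x => by
      rw [← sub_add_sub_cancel x (hyperbolicComplProj ω a b x) (p x)]
      exact add_mem
        (sub_hyperbolicComplProj_mem (subset_span (by simp)) (subset_span (by simp)) _)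
        (sub_hyperbolicComplProj_mem (subset_span (by simp)) (subset_span (by simp)) _))
    (fun x => by simpa using hp x)
  exact ⟨p x, p y, h, hp x, hp y⟩

end hyperbolicComplProj

/-- If `ω` is an alternating bilinear form of rank at least `6` on a finite-dimensional real
vector space and the wedge product `ω ∧ τ` with an alternating bilinear form `τ` vanishes,
then `τ = 0`. -/
theorem alt_form_eq_zero_of_wedge_with_high_rank_form_eq_zero
    {V : Type*} [AddCommGroup V] [Module ℝ V] [FiniteDimensional ℝ V]
    (ω τ : V →ₗ[ℝ] V →ₗ[ℝ] ℝ)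
    (hω : ∀ u : V, ω u u = 0) (hτ : ∀ u : V, τ u u = 0)
    (hrank : 6 ≤ Module.finrank ℝ (LinearMap.range ω))
    (hwedge : ∀ x₁ x₂ x₃ x₄ : V,
      ω x₁ x₂ * τ x₃ x₄ - ω x₁ x₃ * τ x₂ x₄ + ω x₁ x₄ * τ x₂ x₃ +
        ω x₂ x₃ * τ x₁ x₄ - ω x₂ x₄ * τ x₁ x₃ + ω x₃ x₄ * τ x₁ x₂ = 0) :
    τ = 0 := by
  have hneg {x y : V} (h : ω x y = 0) : ω y x = 0 := LinearMap.IsAlt.isRefl hω x y h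
  have hpairs {a b c d : V} (hca : ω c a = 0) (hcb : ω c b = 0) (hda : ω d a = 0)
      (hdb : ω d b = 0) : ω a b * τ c d + ω c d * τ a b = 0 := by
    simpa [hneg hca, hneg hcb, hneg hda, hneg hdb] using hwedge a b c d
  have hzero {a b : V} (hab : ω a b ≠ 0) : τ a b = 0 := by
    obtain ⟨c, d, hcd, hca, hcb, hda, hdb⟩ := exists_hyperbolic_pair_ortho hω (by omega) hab
    obtain ⟨e, f, hef, ⟨hea, heb, hec, hed⟩, hfa, hfb, hfc, hfd⟩ :=
      exists_hyperbolic_pair_ortho_of_pairs hω (by omega) hab hcd hca hcb hda hdb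
    have hac := hpairs hca hcb hda hdb
    have hae := hpairs hea heb hfa hfb
    have hce := hpairs hec hed hfc hfd
    have : 2 * ω c d * ω e f * τ a b = 0 := by
      linear_combination ω e f * hac + ω c d * hae - ω a b * hce
    simpa [hcd, hef] using this
  have hzero' {a : V} (ha : ω a ≠ 0) : τ a = 0 := by
    obtain ⟨b', hb'⟩ := DFunLike.ne_iff.1 ha
    ext b
    by_cases hab : ω a b = 0
    · have hadd : τ a (b + b') = 0 := hzero (by simpa [hab] using hb')
      simpa [hzero hb'] using hadd
    · exact hzero hab
  have hne : ω ≠ 0 := by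
    rintro rfl
    rw [LinearMap.range_zero, finrank_bot] at hrank
    omega
  obtain ⟨a', ha'⟩ := DFunLike.ne_iff.1 hne
  refine LinearMap.ext fun a => ?_
  by_cases ha : ω a = 0
  · have hadd : τ (a + a') = 0 := hzero' (by simpa [ha] using ha')
    simpa [hzero' ha'] using hadd
  · exact hzero' ha
end

section
/- Let 𝔤 be a finite-dimensional real Lie algebra, F : 𝔤 × 𝔤 → ℝ an alternating bilinear form whose rank is at least 6 (i.e. the linear map 𝔤 → 𝔤*, v ↦ F(v,·), has rank at least 6), and η : 𝔤 → ℝ a linear functional such that F([u,v],w) + F([v,w],u) + F([w,u],v) = η(u)F(v,w) + η(v)F(w,u) + η(w)F(u,v) for all u, v, w ∈ 𝔤 (the Chevalley–Eilenberg form of dF = η∧F). Then η([u, v]) = 0 for all u, v ∈ 𝔤, i.e. η is closed as a Chevalley–Eilenberg 1-cochain. -/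
/-- Applying the Chevalley–Eilenberg differential to `dF = η ∧ F` gives `dη ∧ F = 0`. -/
theorem d_eta_wedge_eq_zero
    {R L : Type*} [CommRing R] [LieRing L] [LieAlgebra R L]
    (F : L →ₗ[R] L →ₗ[R] R) (hAlt : ∀ u : L, F u u = 0) (η : L →ₗ[R] R)
    (hdF : ∀ u v w : L, F ⁅u, v⁆ w + F ⁅v, w⁆ u + F ⁅w, u⁆ v =
      η u * F v w + η v * F w u + η w * F u v) (a b c d : L) :
    η ⁅a, b⁆ * F c d + η ⁅a, c⁆ * F d b + η ⁅a, d⁆ * F b c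
      + η ⁅b, c⁆ * F a d + η ⁅b, d⁆ * F c a + η ⁅c, d⁆ * F a b = 0 := by
  have skew : ∀ x y, F x y = -F y x := fun x y => (LinearMap.IsAlt.neg hAlt y x).symm
  have jacobi (x y z w : L) : F ⁅⁅x, y⁆, z⁆ w = F ⁅⁅x, z⁆, y⁆ w - F ⁅⁅y, z⁆, x⁆ w := by
    rw [← LinearMap.sub_apply, ← map_sub]
    congr 2
    rw [lie_lie x y z, ← lie_skew x ⁅y, z⁆, ← lie_skew y ⁅x, z⁆]
    abel
  have expand (x y z w : L) : F ⁅⁅x, y⁆, z⁆ w + F ⁅z, w⁆ ⁅x, y⁆ - F ⁅⁅x, y⁆, w⁆ z =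
      η ⁅x, y⁆ * F z w - η z * F ⁅x, y⁆ w + η w * F ⁅x, y⁆ z := by
    have h := hdF ⁅x, y⁆ z w
    rw [← lie_skew w ⁅x, y⁆, skew w ⁅x, y⁆, map_neg, LinearMap.neg_apply] at h
    linear_combination h
  have triple (x y z : L) : F ⁅x, y⁆ z + F ⁅y, z⁆ x - F ⁅x, z⁆ y =
      η x * F y z - η y * F x z + η z * F x y := by
    have h := hdF x y z
    rw [← lie_skew z x, skew z x, map_neg, LinearMap.neg_apply] at h
    linear_combination h
  linear_combination
    -expand a b c d + expand a c b d - expand a d b c - expand b c a d + expand b d a c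
      - expand c d a b
      + skew ⁅a, b⁆ ⁅c, d⁆ - skew ⁅a, c⁆ ⁅b, d⁆ + skew ⁅a, d⁆ ⁅b, c⁆
      + jacobi a b c d - jacobi a b d c + jacobi a c d b - jacobi b c d a
      + η a * triple b c d - η b * triple a c d + η c * triple a b d - η d * triple a b c
      + η ⁅a, c⁆ * skew d b + η ⁅b, d⁆ * skew c a

/-- If more than `n` dimensions are in the range of a linear map, some value of it lies outside
the span of any `n` given vectors. -/
theorem exists_apply_notMem_span {K V W : Type*} [Field K] [AddCommGroup V] [Module K V]
    [AddCommGroup W] [Module K W] (f : V →ₗ[K] W) {n : ℕ}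
    (hn : n < Module.finrank K (LinearMap.range f)) (w : Fin n → W) :
    ∃ x, f x ∉ Submodule.span K (Set.range w) := by
  by_contra! h
  have hle : LinearMap.range f ≤ Submodule.span K (Set.range w) := by
    rintro _ ⟨x, rfl⟩
    exact h x
  have hfin : FiniteDimensional K (Submodule.span K (Set.range w)) :=
    FiniteDimensional.span_of_finite K (Set.finite_range w)
  have h₁ := Submodule.finrank_mono hle
  have h₂ := finrank_range_le_card (R := K) w
  rw [Fintype.card_fin] at h₂
  exact absurd hn (not_lt.mpr (h₁.trans h₂))

/-- A hyperbolic pair of an alternating form of rank at least `3` is orthogonal to another one. -/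
theorem exists_orthogonal_hyperbolic_pair {K V : Type*} [Field K] [AddCommGroup V] [Module K V]
    (F : V →ₗ[K] V →ₗ[K] K) (hAlt : ∀ u, F u u = 0)
    (hrank : 2 < Module.finrank K (LinearMap.range F)) {u v : V} (huv : F u v = 1) :
    ∃ a b, F a b = 1 ∧ F u a = 0 ∧ F u b = 0 ∧ F v a = 0 ∧ F v b = 0 := by
  have skew : ∀ x y, F x y = -F y x := fun x y => (LinearMap.IsAlt.neg hAlt y x).symm
  have hvu : F v u = -1 := by rw [skew, huv]
  obtain ⟨x, hx⟩ := exists_apply_notMem_span F hrank ![F u, F v]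
  set a := x + F v x • u - F u x • v with ha
  have hua : F u a = 0 := by simp [ha, hAlt, huv]
  have hva : F v a = 0 := by simp [ha, hAlt, hvu]
  have hFa : F a ≠ 0 := by
    intro h
    apply hx
    have : F x = F u x • F v - F v x • F u := by
      rw [ha, map_sub, map_add, map_smul, map_smul] at h
      linear_combination (norm := module) h
    rw [this]
    exact sub_mem (Submodule.smul_mem _ _ (Submodule.subset_span ⟨1, rfl⟩))
      (Submodule.smul_mem _ _ (Submodule.subset_span ⟨0, rfl⟩))
  obtain ⟨y, hy⟩ : ∃ y, F a y ≠ 0 := by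
    by_contra! h
    exact hFa (LinearMap.ext h)
  have hau : F a u = 0 := by rw [skew, hua, neg_zero]
  have hav : F a v = 0 := by rw [skew, hva, neg_zero]
  refine ⟨a, (F a y)⁻¹ • (y + F v y • u - F u y • v), ?_, hua, ?_, hva, ?_⟩
  · simp [hau, hav, hy]
  · simp [hAlt, huv]
  · simp [hAlt, hvu]

/-- Two orthogonal hyperbolic pairs of an alternating form of rank at least `5` are orthogonal
to a third one. -/
theorem exists_orthogonal_hyperbolic_pair_of_two {K V : Type*} [Field K] [AddCommGroup V]
    [Module K V] (F : V →ₗ[K] V →ₗ[K] K) (hAlt : ∀ u, F u u = 0)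
    (hrank : 4 < Module.finrank K (LinearMap.range F)) {u v a b : V}
    (huv : F u v = 1) (hab : F a b = 1)
    (hua : F u a = 0) (hub : F u b = 0) (hva : F v a = 0) (hvb : F v b = 0) :
    ∃ c d, F c d = 1 ∧ F u c = 0 ∧ F u d = 0 ∧ F v c = 0 ∧ F v d = 0 ∧
      F a c = 0 ∧ F a d = 0 ∧ F b c = 0 ∧ F b d = 0 := by
  have skew : ∀ x y, F x y = -F y x := fun x y => (LinearMap.IsAlt.neg hAlt y x).symm
  have hvu : F v u = -1 := by rw [skew, huv]
  have hba : F b a = -1 := by rw [skew, hab]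
  have hau : F a u = 0 := by rw [skew, hua, neg_zero]
  have hav : F a v = 0 := by rw [skew, hva, neg_zero]
  have hbu : F b u = 0 := by rw [skew, hub, neg_zero]
  have hbv : F b v = 0 := by rw [skew, hvb, neg_zero]
  obtain ⟨x, hx⟩ := exists_apply_notMem_span F hrank ![F u, F v, F a, F b]
  set c := x + F v x • u - F u x • v + F b x • a - F a x • b with hc
  have huc : F u c = 0 := by simp [hc, hAlt, huv, hua, hub]
  have hvc : F v c = 0 := by simp [hc, hAlt, hvu, hva, hvb]
  have hac : F a c = 0 := by simp [hc, hAlt, hab, hau, hav]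
  have hbc : F b c = 0 := by simp [hc, hAlt, hba, hbu, hbv]
  have hFc : F c ≠ 0 := by
    intro h
    apply hx
    have : F x = F u x • F v - F v x • F u + F a x • F b - F b x • F a := by
      rw [hc] at h
      simp only [map_sub, map_add, map_smul] at h
      linear_combination (norm := module) h
    rw [this]
    exact sub_mem (add_mem (sub_mem
      (Submodule.smul_mem _ _ (Submodule.subset_span ⟨1, rfl⟩))
      (Submodule.smul_mem _ _ (Submodule.subset_span ⟨0, rfl⟩)))
      (Submodule.smul_mem _ _ (Submodule.subset_span ⟨3, rfl⟩)))
      (Submodule.smul_mem _ _ (Submodule.subset_span ⟨2, rfl⟩))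
  obtain ⟨y, hy⟩ : ∃ y, F c y ≠ 0 := by
    by_contra! h
    exact hFc (LinearMap.ext h)
  have hcu : F c u = 0 := by rw [skew, huc, neg_zero]
  have hcv : F c v = 0 := by rw [skew, hvc, neg_zero]
  have hca : F c a = 0 := by rw [skew, hac, neg_zero]
  have hcb : F c b = 0 := by rw [skew, hbc, neg_zero]
  refine ⟨c, (F c y)⁻¹ • (y + F v y • u - F u y • v + F b y • a - F a y • b),
    ?_, huc, ?_, hvc, ?_, hac, ?_, hbc, ?_⟩
  · simp [hcu, hcv, hca, hcb, hy]
  · simp [hAlt, huv, hua, hub]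
  · simp [hAlt, hvu, hva, hvb]
  · simp [hAlt, hab, hau, hav]
  · simp [hAlt, hba, hbu, hbv]

/-- A bilinear map that vanishes wherever a nonzero bilinear form does not is zero. -/
theorem apply_eq_zero_of_vanishing_where_ne_zero {K V : Type*} [Field K] [AddCommGroup V]
    [Module K V] (F ω : V →ₗ[K] V →ₗ[K] K) (hF : F ≠ 0)
    (h : ∀ u v, F u v ≠ 0 → ω u v = 0) (u v : V) : ω u v = 0 := by
  have right (u v : V) (hu : F u ≠ 0) : ω u v = 0 := by
    by_cases huv : F u v = 0
    · obtain ⟨w, hw⟩ : ∃ w, F u w ≠ 0 := by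
        by_contra! h'
        exact hu (LinearMap.ext h')
      have h₁ := h u (v + w) (by simpa [huv] using hw)
      rwa [map_add, h u w hw, add_zero] at h₁
    · exact h u v huv
  by_cases hu : F u = 0
  · obtain ⟨p, hp⟩ : ∃ p, F p ≠ 0 := by
      by_contra! h'
      exact hF (LinearMap.ext h')
    have h₁ := right (u + p) v (by simpa [hu] using hp)
    rwa [map_add, LinearMap.add_apply, right p v hp, add_zero] at h₁
  · exact right u v hu

/-- If `F` is an alternating bilinear form of rank at least `6` on a finite-dimensional real
Lie algebra and `dF = η ∧ F` in Chevalley–Eilenberg terms, then `η` is closed: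
`η ⁅u, v⁆ = 0` for all `u, v`. -/
theorem eta_closed_of_dF_eq_eta_wedge_F
    {L : Type*} [LieRing L] [LieAlgebra ℝ L] [Module.Finite ℝ L]
    (F : L →ₗ[ℝ] L →ₗ[ℝ] ℝ) (hAlt : ∀ u : L, F u u = 0)
    (η : L →ₗ[ℝ] ℝ)
    (hrank : 6 ≤ Module.finrank ℝ (LinearMap.range F))
    (hdF : ∀ u v w : L, F ⁅u, v⁆ w + F ⁅v, w⁆ u + F ⁅w, u⁆ v =
      η u * F v w + η v * F w u + η w * F u v) :
    ∀ u v : L, η ⁅u, v⁆ = 0 := by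
  have skew : ∀ x y, F x y = -F y x := fun x y => (LinearMap.IsAlt.neg hAlt y x).symm
  have hwedge {x y z w : L} (hxy : F x z = 0) (hxw : F x w = 0) (hyz : F y z = 0)
      (hyw : F y w = 0) : η ⁅x, y⁆ * F z w + η ⁅z, w⁆ * F x y = 0 := by
    have h := d_eta_wedge_eq_zero F hAlt η hdF x y z w
    rw [skew w y, skew z x, hxy, hxw, hyz, hyw] at h
    linear_combination h
  have hunit (u v : L) (huv : F u v = 1) : η ⁅u, v⁆ = 0 := by
    obtain ⟨a, b, hab, hua, hub, hva, hvb⟩ :=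
      exists_orthogonal_hyperbolic_pair F hAlt (by lia) huv
    obtain ⟨c, d, hcd, huc, hud, hvc, hvd, hac, had, hbc, hbd⟩ :=
      exists_orthogonal_hyperbolic_pair_of_two F hAlt (by lia) huv hab hua hub hva hvb
    have h₁ := hwedge hua hub hva hvb
    have h₂ := hwedge huc hud hvc hvd
    have h₃ := hwedge hac had hbc hbd
    rw [huv, hab] at h₁
    rw [huv, hcd] at h₂
    rw [hab, hcd] at h₃
    linarith
  have hF : F ≠ 0 := by
    intro h
    rw [h, LinearMap.range_zero, finrank_bot] at hrank
    lia
  refine apply_eq_zero_of_vanishing_where_ne_zero F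
    ((LieModule.toEnd ℝ L L : L →ₗ[ℝ] Module.End ℝ L).compr₂ η) hF fun u v huv => ?_
  have h := hunit u ((F u v)⁻¹ • v) (by simp [huv])
  rw [lie_smul, map_smul, smul_eq_mul] at h
  exact (mul_eq_zero.mp h).resolve_left (inv_ne_zero huv)
end
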